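/- Let (K,d) be a based complex over a field whose digraph G_K is finite, and let μ be a Morse matching on G_K. With d̃ and h̃ defined from μ and δ = d − d̃, the map h̃δ is locally nilpotent: for every c ∈ K there exists m ∈ ℕ such that (h̃δ)^m(c) = 0. -/

import Mathlib

open LinearMap Submodule

/-! ## Gradings of vector spaces -/

/-- An internal grading of a vector space `V` by an index type `ι`, given by a
system of orthogonal idempotent projections which sum (pointwise, with finite
support) to the identity.  The graded piece at `i` is the range of `proj i`. -/
structure VGrading (k V ι : Type*) [Field k] [AddCommGroup V] [Module k V] where
  proj : ι → V →ₗ[k] V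
  proj_idem : ∀ i, proj i ∘ₗ proj i = proj i
  proj_orth : ∀ i j, i ≠ j → proj i ∘ₗ proj j = 0
  proj_finite : ∀ v : V, (Function.support fun i => proj i v).Finite
  proj_total : ∀ v : V, (∑ᶠ i, proj i v) = v

namespace VGrading

variable {k V ι : Type*} [Field k] [AddCommGroup V] [Module k V]

/-- The graded piece of a grading at index `i`. -/
def piece (G : VGrading k V ι) (i : ι) : Submodule k V := LinearMap.range (G.proj i)

end VGrading

/-- The `(i,j)` component of a linear map between `ι`-graded vector spaces:
include the `j`-th piece, apply `f`, project to the `i`-th piece. -/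
def gcomp {k V W ι : Type*} [Field k] [AddCommGroup V] [Module k V]
    [AddCommGroup W] [Module k W]
    (GW : VGrading k W ι) (GV : VGrading k V ι) (f : V →ₗ[k] W) (i j : ι) :
    V →ₗ[k] W :=
  GW.proj i ∘ₗ (f ∘ₗ GV.proj j)

/-! ## Contractions and perturbations -/

/-- A contraction `(f, g, h)` from the differential `dC` on `V` onto the
differential `dD` on `W`: `f, g` are chain maps, `f ∘ g = 1`,
`g ∘ f = 1 + dC h + h dC`, and the side conditions `f h = 0`, `h g = 0`,
`h h = 0` hold. -/
structure IsContraction {k V W : Type*} [Field k] [AddCommGroup V] [Module k V]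
    [AddCommGroup W] [Module k W]
    (dC : V →ₗ[k] V) (dD : W →ₗ[k] W)
    (f : V →ₗ[k] W) (g : W →ₗ[k] V) (h : V →ₗ[k] V) : Prop where
  f_chain : f ∘ₗ dC = dD ∘ₗ f
  g_chain : g ∘ₗ dD = dC ∘ₗ g
  fg : f ∘ₗ g = LinearMap.id
  gf : g ∘ₗ f = LinearMap.id + dC ∘ₗ h + h ∘ₗ dC
  fh : f ∘ₗ h = 0
  hg : h ∘ₗ g = 0
  hh : h ∘ₗ h = 0

/-- Iterated composition of an endomorphism. -/
def endPow {k V : Type*} [Field k] [AddCommGroup V] [Module k V]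
    (f : V →ₗ[k] V) : ℕ → (V →ₗ[k] V)
  | 0 => LinearMap.id
  | n + 1 => f ∘ₗ endPow f n

/-- `S` is the sum `Σ_{n ≥ 0} δ (h δ)^n`, which is well defined whenever
`h δ` is locally nilpotent: on every vector the series is eventually zero and
`S` is given by the corresponding finite partial sum. -/
def IsPerturbSum {k V : Type*} [Field k] [AddCommGroup V] [Module k V]
    (δ h S : V →ₗ[k] V) : Prop :=
  ∀ v : V, ∃ N : ℕ, (∀ m : ℕ, N ≤ m → endPow (h ∘ₗ δ) m v = 0) ∧
    S v = ∑ i ∈ Finset.range N, (δ ∘ₗ endPow (h ∘ₗ δ) i) v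

/-! ## Chain complexes over a field (graded by `ℤ`) -/

/-- A chain complex of `k`-vector spaces, realised internally to a single
carrier `V`: a `ℤ`-grading together with a square-zero differential of
degree `-1`. -/
structure ZCC (k V : Type*) [Field k] [AddCommGroup V] [Module k V] where
  gr : VGrading k V ℤ
  d : V →ₗ[k] V
  d_sq : d ∘ₗ d = 0
  d_deg : ∀ n : ℤ, ∀ v ∈ gr.piece n, d v ∈ gr.piece (n - 1)

namespace ZCC

variable {k V : Type*} [Field k] [AddCommGroup V] [Module k V]

/-- `n`-cycles. -/
def cycles (C : ZCC k V) (n : ℤ) : Submodule k V := C.gr.piece n ⊓ LinearMap.ker C.d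

/-- `n`-boundaries. -/
def bdries (C : ZCC k V) (n : ℤ) : Submodule k V := (C.gr.piece (n + 1)).map C.d

/-- The `n`-th homology `ker d_n / im d_{n+1}`. -/
abbrev homology (C : ZCC k V) (n : ℤ) :=
  ↥(C.cycles n) ⧸ Submodule.comap (C.cycles n).subtype (C.bdries n)

/-- A chain complex is bounded if only finitely many chain groups are nonzero. -/
def Bounded (C : ZCC k V) : Prop := {n : ℤ | C.gr.proj n ≠ 0}.Finite

end ZCC

/-- A map between `ℤ`-graded spaces has degree `r`. -/
def HasDeg {k V W : Type*} [Field k] [AddCommGroup V] [Module k V]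
    [AddCommGroup W] [Module k W]
    (GV : VGrading k V ℤ) (GW : VGrading k W ℤ) (f : V →ₗ[k] W) (r : ℤ) : Prop :=
  ∀ n : ℤ, ∀ v ∈ GV.piece n, f v ∈ GW.piece (n + r)

/-! ## Based complexes and algebraic Morse theory -/

/-- A based complex: a chain complex whose chain groups are further decomposed
as direct sums indexed by `ι`; `deg : ι → ℤ` records which chain group each
basis index belongs to.  Components of the differential can only drop the
degree by one. -/
structure BasedComplex (k V ι : Type*) [Field k] [AddCommGroup V] [Module k V] where
  gr : VGrading k V ι
  deg : ι → ℤ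
  d : V →ₗ[k] V
  d_sq : d ∘ₗ d = 0
  d_comp_deg : ∀ α β : ι, deg β ≠ deg α - 1 → gr.proj β ∘ₗ (d ∘ₗ gr.proj α) = 0

namespace BasedComplex

variable {k V ι : Type*} [Field k] [AddCommGroup V] [Module k V]

/-- The component `d^{βα} : K^α → K^β` of the differential (as an endomorphism
of the carrier). -/
def dcomp (K : BasedComplex k V ι) (β α : ι) : V →ₗ[k] V :=
  K.gr.proj β ∘ₗ (K.d ∘ₗ K.gr.proj α)

/-- The digraph `G_K`: there is an edge `α → β` whenever `d^{βα} ≠ 0`. -/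
def Edge (K : BasedComplex k V ι) (α β : ι) : Prop := K.dcomp β α ≠ 0

/-- The component `d^{βα}` restricts to an isomorphism `K^α → K^β`. -/
def CompIso (K : BasedComplex k V ι) (α β : ι) : Prop :=
  (∀ v ∈ K.gr.piece α, K.dcomp β α v = 0 → v = 0) ∧
  (K.gr.piece α).map (K.dcomp β α) = K.gr.piece β

/-- The edge relation of the digraph `G^μ_K` obtained from `G_K` by reversing
exactly the edges in `μ`. -/
def MuEdge (K : BasedComplex k V ι) (μ : Set (ι × ι)) (α β : ι) : Prop :=
  (K.Edge α β ∧ (α, β) ∉ μ) ∨ (β, α) ∈ μ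

/-- A partial matching on `G_K`: a set of edges, no two of which share a
vertex. -/
def IsPartialMatching (K : BasedComplex k V ι) (μ : Set (ι × ι)) : Prop :=
  (∀ e ∈ μ, K.Edge e.1 e.2) ∧
  ∀ e ∈ μ, ∀ e' ∈ μ, e ≠ e' → e.1 ≠ e'.1 ∧ e.1 ≠ e'.2 ∧ e.2 ≠ e'.1 ∧ e.2 ≠ e'.2

/-- A Morse matching: a partial matching all of whose matched components are
isomorphisms, together with a well-founded (strict) partial order on each
`I_n` such that any path `α → γ → β` in `G^μ_K` between indices of the same
degree satisfies `β ≺ α`. -/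
def IsMorseMatching (K : BasedComplex k V ι) (μ : Set (ι × ι)) : Prop :=
  K.IsPartialMatching μ ∧ (∀ e ∈ μ, K.CompIso e.1 e.2) ∧
  ∃ r : ι → ι → Prop, (∀ a b, r a b → K.deg a = K.deg b) ∧ Transitive r ∧
    WellFounded r ∧
    ∀ α γ β : ι, K.deg β = K.deg α → K.MuEdge μ α γ → K.MuEdge μ γ β → r β α

/-- A vertex is critical for the matching `μ` if it is incident to no edge
of `μ`. -/
def IsCritical (μ : Set (ι × ι)) (α : ι) : Prop := ∀ e ∈ μ, e.1 ≠ α ∧ e.2 ≠ α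

/-- The map `d̃`: the sum of the matched components of the differential. -/
noncomputable def dtilde (K : BasedComplex k V ι) (μ : Set (ι × ι)) : V →ₗ[k] V :=
  ∑ᶠ (e : ι × ι) (_ : e ∈ μ), K.dcomp e.2 e.1

/-- The projection onto the span of the critical pieces. -/
noncomputable def critProj (K : BasedComplex k V ι) (μ : Set (ι × ι)) : V →ₗ[k] V :=
  ∑ᶠ (α : ι) (_ : IsCritical μ α), K.gr.proj α

/-- The span of the critical pieces, i.e. the chain groups of the Morse
complex `K^{(μ)}`. -/
def critSub (K : BasedComplex k V ι) (μ : Set (ι × ι)) : Submodule k V :=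
  ⨆ (α : ι) (_ : IsCritical μ α), K.gr.piece α

/-- `ht` is the map `h̃` associated to the matching: it vanishes on every
piece which is not the target of a matched edge, and on the piece `K^β` with
`(α → β) ∈ μ` it is minus the inverse of `d^{βα}`. -/
def IsHTildeB (K : BasedComplex k V ι) (μ : Set (ι × ι)) (ht : V →ₗ[k] V) : Prop :=
  (∀ c : ι, (¬ ∃ a : ι, (a, c) ∈ μ) → ht ∘ₗ K.gr.proj c = 0) ∧
  ∀ a b : ι, (a, b) ∈ μ → ∀ v ∈ K.gr.piece b,
    ht v ∈ K.gr.piece a ∧ K.dcomp b a (ht v) = -v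

end BasedComplex

/-! ## `P`-graded chain complexes -/

/-- A `P`-graded chain complex: the carrier is graded by `ℤ × P`
(chain degree and poset grade), the differential is square-zero, drops the
chain degree by one and is `P`-filtered: components from grade `q` to grade
`p` vanish unless `p ≤ q`. -/
structure PCC (k V P : Type*) [Field k] [AddCommGroup V] [Module k V]
    [PartialOrder P] where
  gr : VGrading k V (ℤ × P)
  d : V →ₗ[k] V
  d_sq : d ∘ₗ d = 0
  d_filt : ∀ (n m : ℤ) (p q : P),
    (m = n - 1 ∧ p ≤ q) ∨ gr.proj (m, p) ∘ₗ (d ∘ₗ gr.proj (n, q)) = 0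

namespace PCC

variable {k V P : Type*} [Field k] [AddCommGroup V] [Module k V] [PartialOrder P]

/-- The twisted differential `t^{pq}_n : C^q_n → C^p_{n-1}`
(as an endomorphism of the carrier). -/
def tcomp (C : PCC k V P) (n : ℤ) (p q : P) : V →ₗ[k] V :=
  C.gr.proj (n - 1, p) ∘ₗ (C.d ∘ₗ C.gr.proj (n, q))

/-- Only finitely many chain groups are nonzero. -/
def Bounded (C : PCC k V P) : Prop := {i : ℤ × P | C.gr.proj i ≠ 0}.Finite

/-- Cycles of the relative chain complex `(C^p, t^p)` in degree `n`. -/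
def relCycles (C : PCC k V P) (n : ℤ) (p : P) : Submodule k V :=
  LinearMap.range (C.gr.proj (n, p)) ⊓ LinearMap.ker (C.tcomp n p p)

/-- Boundaries of the relative chain complex `(C^p, t^p)` in degree `n`. -/
def relBdries (C : PCC k V P) (n : ℤ) (p : P) : Submodule k V :=
  LinearMap.range (C.tcomp (n + 1) p p)

/-- The relative homology `H_n(C^p, t^p)`. -/
abbrev relHomology (C : PCC k V P) (n : ℤ) (p : P) :=
  ↥(C.relCycles n p) ⧸ Submodule.comap (C.relCycles n p).subtype (C.relBdries n p)

/-- The diagonal part `d̃ = Σ_p t^p` of the differential. -/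
noncomputable def dtilde (C : PCC k V P) : V →ₗ[k] V :=
  ∑ᶠ i : ℤ × P, C.gr.proj (i.1 - 1, i.2) ∘ₗ (C.d ∘ₗ C.gr.proj i)

/-- The strictly off-diagonal part `δ = Σ_{p < q} t^{pq} = d - d̃` of the
differential. -/
noncomputable def delta (C : PCC k V P) : V →ₗ[k] V := C.d - C.dtilde

/-- The sublevel subcomplex `F^p = ⊕_{q ≤ p} C^q`. -/
def Fle (C : PCC k V P) (p : P) : Submodule k V :=
  ⨆ (i : ℤ × P) (_ : i.2 ≤ p), LinearMap.range (C.gr.proj i)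

/-- The strict sublevel subcomplex `F^p̌ = ⊕_{q < p} C^q`. -/
def Flt (C : PCC k V P) (p : P) : Submodule k V :=
  ⨆ (i : ℤ × P) (_ : i.2 < p), LinearMap.range (C.gr.proj i)

/-- The total relative chain group `C^p = ⊕_n C^p_n` at grade `p`. -/
def Cp (C : PCC k V P) (p : P) : Submodule k V :=
  ⨆ n : ℤ, LinearMap.range (C.gr.proj (n, p))

end PCC

/-- A linear map between `(ℤ × P)`-graded spaces is `P`-filtered: its
components from grade `q` to grade `p` vanish unless `p ≤ q`. -/
def PFilt {k V W P : Type*} [Field k] [AddCommGroup V] [Module k V]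
    [AddCommGroup W] [Module k W] [PartialOrder P]
    (GV : VGrading k V (ℤ × P)) (GW : VGrading k W (ℤ × P)) (f : V →ₗ[k] W) : Prop :=
  ∀ (n m : ℤ) (p q : P), ¬ p ≤ q → GW.proj (m, p) ∘ₗ (f ∘ₗ GV.proj (n, q)) = 0

/-- A linear map between `(ℤ × P)`-graded spaces has chain degree `r`. -/
def HasDegZP {k V W P : Type*} [Field k] [AddCommGroup V] [Module k V]
    [AddCommGroup W] [Module k W] [PartialOrder P]
    (GV : VGrading k V (ℤ × P)) (GW : VGrading k W (ℤ × P)) (f : V →ₗ[k] W)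
    (r : ℤ) : Prop :=
  ∀ (n m : ℤ) (p q : P), m ≠ n + r → GW.proj (m, q) ∘ₗ (f ∘ₗ GV.proj (n, p)) = 0

/-- A linear map between `P`-graded spaces is `P`-filtered. -/
def PFilt0 {k V W P : Type*} [Field k] [AddCommGroup V] [Module k V]
    [AddCommGroup W] [Module k W] [PartialOrder P]
    (GW : VGrading k W P) (GV : VGrading k V P) (f : V →ₗ[k] W) : Prop :=
  ∀ p q : P, ¬ p ≤ q → GW.proj p ∘ₗ (f ∘ₗ GV.proj q) = 0

/-! ## Consistent splittings -/

/-- A consistent splitting of a `P`-graded chain complex: each relative chain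
group `C^p_n` is split as an internal direct sum `M^p_n ⊕ B^p_n ⊕ K^p_n`
(recorded by three orthogonal idempotents summing to the grading projection),
where the `B`-summand is the space of relative boundaries `im(t^p_{n+1})`,
the `M`- and `B`-summands together span the relative cycles `ker(t^p_n)`,
and `t^p_n` maps the `K`-summand isomorphically onto `B^p_{n-1}`. -/
structure ConsSplit {k V P : Type*} [Field k] [AddCommGroup V] [Module k V]
    [PartialOrder P] (C : PCC k V P) where
  piM : ℤ → P → (V →ₗ[k] V)
  piB : ℤ → P → (V →ₗ[k] V)
  piK : ℤ → P → (V →ₗ[k] V)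
  sum_eq : ∀ n p, piM n p + piB n p + piK n p = C.gr.proj (n, p)
  idem_M : ∀ n p, piM n p ∘ₗ piM n p = piM n p
  idem_B : ∀ n p, piB n p ∘ₗ piB n p = piB n p
  idem_K : ∀ n p, piK n p ∘ₗ piK n p = piK n p
  orth_MB : ∀ n p, piM n p ∘ₗ piB n p = 0
  orth_BM : ∀ n p, piB n p ∘ₗ piM n p = 0
  orth_MK : ∀ n p, piM n p ∘ₗ piK n p = 0
  orth_KM : ∀ n p, piK n p ∘ₗ piM n p = 0
  orth_BK : ∀ n p, piB n p ∘ₗ piK n p = 0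
  orth_KB : ∀ n p, piK n p ∘ₗ piB n p = 0
  range_B : ∀ n p, LinearMap.range (piB n p) = LinearMap.range (C.tcomp (n + 1) p p)
  ker_split : ∀ n p, LinearMap.range (piM n p) ⊔ LinearMap.range (piB n p)
      = LinearMap.range (C.gr.proj (n, p)) ⊓ LinearMap.ker (C.tcomp n p p)
  K_inj : ∀ n p, ∀ v ∈ LinearMap.range (piK n p), C.tcomp n p p v = 0 → v = 0
  K_onto : ∀ n p, (LinearMap.range (piK n p)).map (C.tcomp n p p)
      = LinearMap.range (piB (n - 1) p)

namespace ConsSplit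

variable {k V P : Type*} [Field k] [AddCommGroup V] [Module k V] [PartialOrder P]
  {C : PCC k V P}

/-- The projection `j_M` onto the total Morse summand `M = ⊕_{n,p} M^p_n`. -/
noncomputable def projM (sp : ConsSplit C) : V →ₗ[k] V := ∑ᶠ i : ℤ × P, sp.piM i.1 i.2

/-- The projection `j_K` onto the total preboundary summand. -/
noncomputable def projK (sp : ConsSplit C) : V →ₗ[k] V := ∑ᶠ i : ℤ × P, sp.piK i.1 i.2

/-- The total Morse summand `M = ⊕_{n,p} M^p_n` as a submodule; this is the
underlying space of the Conley (Morse) complex. -/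
def Msub (sp : ConsSplit C) : Submodule k V := ⨆ i : ℤ × P, LinearMap.range (sp.piM i.1 i.2)

/-- The differential `d̃ = i_B ∘ (⊕_p t^p|_{K^p}) ∘ j_K`. -/
noncomputable def dtildeK (sp : ConsSplit C) : V →ₗ[k] V :=
  ∑ᶠ i : ℤ × P, C.tcomp i.1 i.2 i.2 ∘ₗ sp.piK i.1 i.2

/-- `ht` is the map `h̃ = -i_K ∘ (⊕_p (t^p|_{K^p})^{-1}) ∘ j_B`: it vanishes on
the `M`- and `K`-summands, and on each `B^p_n` it is minus the inverse of the
isomorphism `t^p_{n+1} : K^p_{n+1} → B^p_n`. -/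
def IsHTilde (sp : ConsSplit C) (ht : V →ₗ[k] V) : Prop :=
  (∀ n p, ht ∘ₗ sp.piM n p = 0) ∧ (∀ n p, ht ∘ₗ sp.piK n p = 0) ∧
  ∀ n p, ∀ v ∈ LinearMap.range (sp.piB n p),
    ht v ∈ LinearMap.range (sp.piK (n + 1) p) ∧ C.tcomp (n + 1) p p (ht v) = -v

end ConsSplit

/-! ## Ordered bases, pivots and separating bases -/

/-- `i` is the pivot index of `v` with respect to the coordinate functions
`coord`: the largest index at which `v` has a nonzero coefficient. -/
def IsPivot {k V : Type*} [Field k] [AddCommGroup V] [Module k V] {m : ℕ}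
    (coord : Fin m → V →ₗ[k] k) (v : V) (i : Fin m) : Prop :=
  coord i v ≠ 0 ∧ ∀ j : Fin m, coord j v ≠ 0 → j ≤ i

/-- `A n` is a totally ordered (by the order of `Fin (m n)`) basis of the
`n`-th chain group, with coordinate functionals `coord n`. -/
def IsOrderedBasisData {k V : Type*} [Field k] [AddCommGroup V] [Module k V]
    (C : ZCC k V) (m : ℤ → ℕ) (A : ∀ n : ℤ, Fin (m n) → V)
    (coord : ∀ n : ℤ, Fin (m n) → V →ₗ[k] k) : Prop :=
  ∀ n : ℤ, (∀ i, A n i ∈ C.gr.piece n) ∧ LinearIndependent k (A n) ∧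
    Submodule.span k (Set.range (A n)) = C.gr.piece n ∧
    ∀ v ∈ C.gr.piece n, v = ∑ i : Fin (m n), coord n i v • A n i

/-- `(H, B, Pp)` is a family of separating bases: for each `n`, the triple
`(H n, B n, Pp n)` is a separating basis for the `n`-th chain group with
respect to the ordered basis `A n`. -/
def IsSepSystem {k V : Type*} [Field k] [AddCommGroup V] [Module k V]
    (C : ZCC k V) (m : ℤ → ℕ) (A : ∀ n : ℤ, Fin (m n) → V)
    (coord : ∀ n : ℤ, Fin (m n) → V →ₗ[k] k) (H B Pp : ℤ → Set V) : Prop :=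
  ∀ n : ℤ,
    (H n ⊆ C.gr.piece n) ∧ (B n ⊆ C.gr.piece n) ∧ (Pp n ⊆ C.gr.piece n) ∧
    (H n).Finite ∧ (B n).Finite ∧ (Pp n).Finite ∧
    LinearIndependent k (fun x : ↥(H n) => (x : V)) ∧
    LinearIndependent k (fun x : ↥(B n) => (x : V)) ∧
    LinearIndependent k (fun x : ↥(Pp n) => (x : V)) ∧
    Disjoint (Submodule.span k (H n)) (Submodule.span k (B n)) ∧
    Disjoint (Submodule.span k (H n) ⊔ Submodule.span k (B n))
      (Submodule.span k (Pp n)) ∧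
    (Submodule.span k (H n) ⊔ Submodule.span k (B n) ⊔ Submodule.span k (Pp n)
      = C.gr.piece n) ∧
    Submodule.span k (B n) = C.bdries n ∧
    (Submodule.span k (H n) ⊔ Submodule.span k (B n) = C.cycles n) ∧
    (∀ v ∈ Pp n, C.d v ∈ B (n - 1)) ∧
    (∀ v ∈ H n ∪ Pp n, ∀ b ∈ B n, ∀ i, IsPivot (coord n) b i → coord n i v = 0) ∧
    (∀ z ∈ H n, ∀ i, IsPivot (coord n) z i →
      ∀ v, ((v ∈ H n ∧ v ≠ z) ∨ v ∈ Pp n) → coord n i v = 0) ∧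
    (∀ z ∈ H n, ∀ i, IsPivot (coord n) z i → coord n i z = 1)

/-- The set of basis vectors which are pivots of elements of `H`. -/
def pivotVecs {k V : Type*} [Field k] [AddCommGroup V] [Module k V] {mm : ℕ}
    (coord : Fin mm → V →ₗ[k] k) (A : Fin mm → V) (H : Set V) : Set V :=
  {w : V | ∃ z ∈ H, ∃ i : Fin mm, IsPivot coord z i ∧ w = A i}

theorem endPow_eq_pow {k V : Type*} [Field k] [AddCommGroup V] [Module k V]
    (f : Module.End k V) (n : ℕ) : endPow f n = f ^ n := by
  induction n with
  | zero => rfl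
  | succ n ih => rw [pow_succ', endPow, ih]; rfl

namespace VGrading

variable {k V ι : Type*} [Field k] [AddCommGroup V] [Module k V]

theorem proj_proj_self (G : VGrading k V ι) (i : ι) (v : V) :
    G.proj i (G.proj i v) = G.proj i v :=
  LinearMap.congr_fun (G.proj_idem i) v

theorem proj_proj_of_ne (G : VGrading k V ι) {i j : ι} (h : i ≠ j) (v : V) :
    G.proj i (G.proj j v) = 0 :=
  LinearMap.congr_fun (G.proj_orth i j h) v

theorem sum_proj [Fintype ι] (G : VGrading k V ι) (v : V) : ∑ i, G.proj i v = v := by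
  rw [← finsum_eq_sum_of_fintype, G.proj_total]

theorem proj_eq_self (G : VGrading k V ι) {i : ι} {v : V} (hv : v ∈ G.piece i) :
    G.proj i v = v := by
  obtain ⟨w, rfl⟩ := hv
  exact G.proj_proj_self i w

/-- An endomorphism that strictly lowers a well-founded relation on the index set of a finite
grading is locally nilpotent. -/
theorem exists_pow_eq_zero [Finite ι] (G : VGrading k V ι) {r : ι → ι → Prop}
    (hr : WellFounded r) (f : Module.End k V)
    (hf : ∀ (S : Submodule k V) (α : ι), (∀ γ, r γ α → G.piece γ ≤ S) →
      ∀ v ∈ G.piece α, f v ∈ S) (c : V) :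
    ∃ m : ℕ, (f ^ m) c = 0 := by
  cases nonempty_fintype ι
  have mem_iff (v : V) : v ∈ f.maxGenEigenspace 0 ↔ ∃ m : ℕ, (f ^ m) v = 0 := by
    simp
  rw [← mem_iff, ← G.sum_proj c]
  refine Submodule.sum_mem _ fun α _ => ?_
  suffices h : ∀ α, G.piece α ≤ f.maxGenEigenspace 0 from h α ⟨c, rfl⟩
  intro α
  induction α using hr.induction with
  | _ α ih =>
    intro v hv
    obtain ⟨m, hm⟩ := (mem_iff _).1 (hf _ α ih v hv)
    exact (mem_iff _).2 ⟨m + 1, by rw [pow_succ]; exact hm⟩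

end VGrading

namespace BasedComplex

variable {k V ι : Type*} [Field k] [AddCommGroup V] [Module k V]

theorem deg_of_edge (K : BasedComplex k V ι) {α β : ι} (h : K.Edge α β) :
    K.deg β = K.deg α - 1 := by
  by_contra hne
  exact h (K.d_comp_deg α β hne)

theorem proj_dtilde_of_mem [Finite ι] (K : BasedComplex k V ι) {μ : Set (ι × ι)} {α β : ι}
    (hαβ : (α, β) ∈ μ) {v : V} (hv : v ∈ K.gr.piece α) :
    K.gr.proj β (K.dtilde μ v) = K.gr.proj β (K.d v) := by
  rw [dtilde, finsum_mem_eq_finite_toFinset_sum _ μ.toFinite, LinearMap.sum_apply, map_sum,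
    Finset.sum_eq_single (α, β)]
  · simp only [dcomp, LinearMap.comp_apply, K.gr.proj_proj_self, K.gr.proj_eq_self hv]
  · rintro ⟨a, b⟩ - hne
    rw [← K.gr.proj_eq_self hv]
    simp only [dcomp, LinearMap.comp_apply]
    by_cases hb : β = b
    · subst hb
      have ha : a ≠ α := fun h => hne (by rw [h])
      rw [K.gr.proj_proj_of_ne ha, map_zero, map_zero, map_zero]
    · rw [K.gr.proj_proj_of_ne hb]
  · intro h
    exact absurd (by simpa using hαβ) h

theorem proj_dtilde_of_notMem [Finite ι] (K : BasedComplex k V ι) {μ : Set (ι × ι)} {α β : ι}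
    (hαβ : (α, β) ∉ μ) {v : V} (hv : v ∈ K.gr.piece α) :
    K.gr.proj β (K.dtilde μ v) = 0 := by
  rw [dtilde, finsum_mem_eq_finite_toFinset_sum _ μ.toFinite, LinearMap.sum_apply, map_sum]
  refine Finset.sum_eq_zero ?_
  rintro ⟨a, b⟩ hab
  rw [← K.gr.proj_eq_self hv]
  simp only [dcomp, LinearMap.comp_apply]
  by_cases hb : β = b
  · subst hb
    have ha : a ≠ α := by
      rintro rfl
      exact hαβ (by simpa using hab)
    rw [K.gr.proj_proj_of_ne ha, map_zero, map_zero, map_zero]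
  · rw [K.gr.proj_proj_of_ne hb]

/-- If the component of `d - d̃` from `K^α` to `K^β` is nonzero then `α → β` is an unmatched
edge. -/
theorem edge_of_proj_delta_ne_zero [Finite ι] (K : BasedComplex k V ι) {μ : Set (ι × ι)}
    {α β : ι} {v : V} (hv : v ∈ K.gr.piece α)
    (h : K.gr.proj β ((K.d - K.dtilde μ) v) ≠ 0) : K.Edge α β ∧ (α, β) ∉ μ := by
  rw [LinearMap.sub_apply, map_sub] at h
  have hαβ : (α, β) ∉ μ := fun hmem => h (by rw [K.proj_dtilde_of_mem hmem hv, sub_self])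
  refine ⟨fun h0 => h ?_, hαβ⟩
  have hd : K.dcomp β α v = 0 := by rw [h0, LinearMap.zero_apply]
  rw [K.proj_dtilde_of_notMem hαβ hv, sub_zero, ← hd]
  simp only [dcomp, LinearMap.comp_apply, K.gr.proj_eq_self hv]

end BasedComplex

/-- Let `(K, d)` be a based complex with finite digraph
`G_K`, and let `μ` be a Morse matching on `G_K`.  With `d̃` and `h̃` defined
from `μ` and `δ = d - d̃`, the map `h̃δ` is locally nilpotent: for every
`c ∈ K` there is `m ∈ ℕ` with `(h̃δ)^m (c) = 0`. -/
theorem stmt17 {k V ι : Type*} [Field k] [AddCommGroup V] [Module k V] [Finite ι]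
    (K : BasedComplex k V ι) (μ : Set (ι × ι)) (hμ : K.IsMorseMatching μ)
    (ht : V →ₗ[k] V) (hht : K.IsHTildeB μ ht) :
    ∀ c : V, ∃ m : ℕ, endPow (ht ∘ₗ (K.d - K.dtilde μ)) m c = 0 := by
  obtain ⟨⟨hedge, -⟩, -, r, -, -, hwf, hr⟩ := hμ
  intro c
  simp only [endPow_eq_pow]
  refine K.gr.exists_pow_eq_zero hwf _ (fun S α hS v hv => ?_) c
  cases nonempty_fintype ι
  rw [LinearMap.comp_apply, ← K.gr.sum_proj ((K.d - K.dtilde μ) v), map_sum]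
  refine Submodule.sum_mem _ fun β _ => ?_
  by_cases hβ : ∃ γ, (γ, β) ∈ μ
  · obtain ⟨γ, hγ⟩ := hβ
    by_cases h0 : K.gr.proj β ((K.d - K.dtilde μ) v) = 0
    · rw [h0, map_zero]
      exact S.zero_mem
    · obtain ⟨hαβ, hnot⟩ := K.edge_of_proj_delta_ne_zero hv h0
      have hdeg : K.deg γ = K.deg α := by
        have h1 := K.deg_of_edge hαβ
        have h2 := K.deg_of_edge (hedge _ hγ)
        dsimp only at h2
        omega
      exact hS γ (hr α β γ hdeg (Or.inl ⟨hαβ, hnot⟩) (Or.inr hγ))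
        (hht.2 γ β hγ _ ⟨_, rfl⟩).1
  · have h := LinearMap.congr_fun (hht.1 β hβ) ((K.d - K.dtilde μ) v)
    rw [LinearMap.comp_apply, LinearMap.zero_apply] at h
    rw [h]
    exact S.zero_mem
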